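/- arXiv:2107.00748 — 2 statements merged into one kernel-verified Lean document; each statement's English description precedes it below -/
import Mathlib

section
/- Let T = (T_a, T_b) be a rooted binary phylogenetic X-tree with |X| = n ≥ 2 and strictly positive edge lengths, with maximal pendant subtrees T_a and T_b having leaf sets X_a and X_b. Let T̃ be the induced subtree obtained from T by deleting a set of leaves X' with ∅ ≠ X' ⊊ X_a (i.e. some but not all leaves of T_a, and none of T_b). Then FP_{T̃}(x) > FP_T(x) for all leaves x ∈ X_a∖X'. -/
open scoped Classical

namespace Phylo

/-- A rooted binary phylogenetic tree with leaf labels of type `α`.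
`node l r a b` is a tree whose root has two children: the roots of `l` and `r`,
where `a` is the length of the edge to the root of `l` and `b` the length of the
edge to the root of `r`.  A tree `leaf x` consists of a single vertex labelled `x`. -/
inductive PhyloTree (α : Type) : Type where
  | leaf : α → PhyloTree α
  | node : PhyloTree α → PhyloTree α → ℝ → ℝ → PhyloTree α

namespace PhyloTree

variable {α : Type} [DecidableEq α]

/-- The set of leaf labels of a tree. -/
def leafSet : PhyloTree α → Finset α
  | leaf x => {x}
  | node l r _ _ => leafSet l ∪ leafSet r

/-- The number of leaves of a tree. -/
def numLeaves (T : PhyloTree α) : ℕ := T.leafSet.card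

/-- All edge lengths of the tree are strictly positive. -/
def posLengths : PhyloTree α → Prop
  | leaf _ => True
  | node l r a b => 0 < a ∧ 0 < b ∧ posLengths l ∧ posLengths r

/-- The leaves of the tree are bijectively labelled (no label occurs twice);
this makes `T` a phylogenetic `X`-tree with `X = T.leafSet`. -/
def distinctLeaves : PhyloTree α → Prop
  | leaf _ => True
  | node l r _ _ => Disjoint l.leafSet r.leafSet ∧ distinctLeaves l ∧ distinctLeaves r

/-- The Fair Proportion index `FP_T(x)`: every edge `e` on the path from the root to `x`
contributes `λ_e / D_e`, where `D_e` is the number of leaves descended from `e`. -/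
noncomputable def FP : PhyloTree α → α → ℝ
  | leaf _, _ => 0
  | node l r a b, x =>
    if x ∈ l.leafSet then FP l x + a / (l.numLeaves : ℝ)
    else if x ∈ r.leafSet then FP r x + b / (r.numLeaves : ℝ)
    else 0

/-- Helper for the induced subtree: `restrict? T Y` returns `none` if no leaf of `T`
survives, and otherwise `some (e, T')` where `T'` is the induced subtree on the
surviving leaves and `e` is the total length of the suppressed unary chain of edges
above the root of `T'` (merged edge lengths are added). -/
noncomputable def restrict? : PhyloTree α → Finset α → Option (ℝ × PhyloTree α)
  | leaf x, Y => if x ∈ Y then some (0, leaf x) else none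
  | node l r a b, Y =>
    match restrict? l Y, restrict? r Y with
    | some (ea, l'), some (eb, r') => some (0, node l' r' (a + ea) (b + eb))
    | some (ea, l'), none => some (a + ea, l')
    | none, some (eb, r') => some (b + eb, r')
    | none, none => none

/-- The induced subtree `T_Y` of `T` on the leaf set `Y` (non-root degree-2 vertices are
suppressed, merged edge lengths are added, and a dangling root edge is deleted).
Junk value `T` if no leaf survives. -/
noncomputable def restrictTree (T : PhyloTree α) (Y : Finset α) : PhyloTree α :=
  match T.restrict? Y with
  | some (_, t) => t
  | none => T

/-- The ranking induced by `FP_T` is strict: `FP_T` is injective on the leaf set. -/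
def strict (T : PhyloTree α) : Prop := Set.InjOn T.FP ↑T.leafSet

/-- The ranking induced by `FP_T` is reversible with respect to `X' ⊂ X`: writing
`T̃ = T_{X \ X'}`, for all surviving leaves `x, y` we have
`FP_T x > FP_T y ↔ FP_T̃ x < FP_T̃ y`. -/
def reversible (T : PhyloTree α) (X' : Finset α) : Prop :=
  ∀ x ∈ T.leafSet \ X', ∀ y ∈ T.leafSet \ X',
    (T.FP y < T.FP x ↔
      (T.restrictTree (T.leafSet \ X')).FP x < (T.restrictTree (T.leafSet \ X')).FP y)

/-- The cherries of `T`: pairs of leaves sharing the same parent. -/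
def cherries : PhyloTree α → Finset (α × α)
  | leaf _ => ∅
  | node (leaf x) (leaf y) _ _ => {(x, y)}
  | node l r _ _ => cherries l ∪ cherries r

/-- `X'` consists of precisely one leaf out of each cherry of `T`. -/
def oneLeafPerCherry (T : PhyloTree α) (X' : Finset α) : Prop :=
  (∀ x ∈ X', ∃ p ∈ T.cherries, x = p.1 ∨ x = p.2) ∧
  ∀ p ∈ T.cherries, (p.1 ∈ X' ∧ p.2 ∉ X') ∨ (p.1 ∉ X' ∧ p.2 ∈ X')

/-- Two trees have the same shape and the same leaf labelling
(only the edge lengths may differ). -/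
def sameShape : PhyloTree α → PhyloTree α → Prop
  | leaf x, leaf y => x = y
  | node l r _ _, node l' r' _ _ => sameShape l l' ∧ sameShape r r'
  | _, _ => False

/-- `T.hasSubtree s`: `s` occurs as a (pendant) subtree of `T`. -/
def hasSubtree : PhyloTree α → PhyloTree α → Prop
  | leaf x, s => leaf x = s
  | node l r a b, s => node l r a b = s ∨ hasSubtree l s ∨ hasSubtree r s

/-- The total edge length of the path from the root to the leaf `x`. -/
noncomputable def depth : PhyloTree α → α → ℝ
  | leaf _, _ => 0
  | node l r a b, x =>
    if x ∈ l.leafSet then depth l x + a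
    else if x ∈ r.leafSet then depth r x + b
    else 0

/-- `T` is ultrametric: all leaves have the same distance to the root. -/
def ultrametric (T : PhyloTree α) : Prop :=
  ∀ x ∈ T.leafSet, ∀ y ∈ T.leafSet, T.depth x = T.depth y

/-- The total sum of the edge lengths of `T`. -/
noncomputable def totalLength : PhyloTree α → ℝ
  | leaf _ => 0
  | node l r a b => a + b + totalLength l + totalLength r

/-- Whether the tree is a single leaf. -/
def isLeafB : PhyloTree α → Bool
  | leaf _ => true
  | node _ _ _ _ => false

/-- Multiply all edge lengths of `T` by `k`. -/
noncomputable def scale (k : ℝ) : PhyloTree α → PhyloTree α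
  | leaf x => leaf x
  | node l r a b => node (scale k l) (scale k r) (k * a) (k * b)

/-- Add `d` to the length of every pendant edge (edge incident to a leaf) of `T`. -/
noncomputable def addPendant (d : ℝ) : PhyloTree α → PhyloTree α
  | leaf x => leaf x
  | node l r a b =>
    node (addPendant d l) (addPendant d r)
      (if l.isLeafB then a + d else a) (if r.isLeafB then b + d else b)

end PhyloTree

end Phylo

namespace Phylo.PhyloTree

theorem leafSet_nonempty' {α : Type} [DecidableEq α] (T : PhyloTree α) : T.leafSet.Nonempty := by
  induction T with
  | leaf x => simp [leafSet]
  | node l r a b ihl ihr => simp only [leafSet]; exact ihl.mono Finset.subset_union_left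

theorem restrict_none {α : Type} [DecidableEq α] (T : PhyloTree α) (Y : Finset α)
    (h : T.restrict? Y = none) : T.leafSet ∩ Y = ∅ := by
  induction T with
  | leaf x =>
    simp only [restrict?] at h
    split_ifs at h with hx
    exact Finset.singleton_inter_of_notMem hx
  | node l r a b ihl ihr =>
    simp only [restrict?] at h
    split at h <;> simp_all [leafSet, Finset.union_inter_distrib_right]

theorem restrict_some {α : Type} [DecidableEq α] (T : PhyloTree α) (Y : Finset α) (e : ℝ)
    (T' : PhyloTree α) (h : T.restrict? Y = some (e, T')) : T'.leafSet = T.leafSet ∩ Y := by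
  induction T generalizing e T' with
  | leaf x =>
    simp only [restrict?] at h
    split_ifs at h with hx
    simp only [Option.some.injEq, Prod.mk.injEq] at h
    rw [← h.2]
    simp [leafSet, hx]
  | node l r a b ihl ihr =>
    simp only [restrict?] at h
    simp only [leafSet, Finset.union_inter_distrib_right]
    split at h
    · rename_i h1 h2
      simp only [Option.some.injEq, Prod.mk.injEq] at h
      rw [← h.2, leafSet, ihl _ _ h1, ihr _ _ h2]
    · rename_i h1 h2
      simp only [Option.some.injEq, Prod.mk.injEq] at h
      rw [← h.2, ihl _ _ h1, restrict_none _ _ h2, Finset.union_empty]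
    · rename_i h1 h2
      simp only [Option.some.injEq, Prod.mk.injEq] at h
      rw [← h.2, ihr _ _ h2, restrict_none _ _ h1, Finset.empty_union]
    · simp at h

theorem numLeaves_pos' {α : Type} [DecidableEq α] (T : PhyloTree α) : (0 : ℝ) < T.numLeaves := by
  exact_mod_cast Finset.card_pos.mpr (leafSet_nonempty' T)

theorem div_le_restrict {α : Type} [DecidableEq α] (T : PhyloTree α) (Y : Finset α) (e : ℝ)
    (T' : PhyloTree α) (h : T.restrict? Y = some (e, T')) (a : ℝ) (ha : 0 < a) :
    a / (T.numLeaves : ℝ) ≤ a / (T'.numLeaves : ℝ) := by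
  apply div_le_div_of_nonneg_left ha.le (numLeaves_pos' T')
  have : T'.numLeaves ≤ T.numLeaves := by
    unfold numLeaves
    rw [restrict_some _ _ _ _ h]
    exact Finset.card_le_card Finset.inter_subset_left
  exact_mod_cast this

theorem FP_le_restrict {α : Type} [DecidableEq α] (T : PhyloTree α) (Y : Finset α) (e : ℝ)
    (T' : PhyloTree α) (hpos : T.posLengths) (h : T.restrict? Y = some (e, T')) (x : α)
    (hx : x ∈ T.leafSet) (hY : x ∈ Y) : T.FP x ≤ T'.FP x + e / (T'.numLeaves : ℝ) := by
  induction T generalizing e T' with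
  | leaf y =>
    simp only [restrict?] at h
    split_ifs at h with hx
    simp only [Option.some.injEq, Prod.mk.injEq] at h
    rw [← h.2, ← h.1]
    simp [FP]
  | node l r a b ihl ihr =>
    obtain ⟨ha, hb, hl, hr⟩ := hpos
    simp only [leafSet, Finset.mem_union] at hx
    simp only [restrict?] at h
    split at h
    · rename_i ea l' eb r' h1 h2
      simp only [Option.some.injEq, Prod.mk.injEq] at h
      rw [← h.2, ← h.1]
      have m1 := restrict_some _ _ _ _ h1
      have m2 := restrict_some _ _ _ _ h2
      have d1 := div_le_restrict _ _ _ _ h1 a ha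
      have d2 := div_le_restrict _ _ _ _ h2 b hb
      simp only [FP, m1, m2, Finset.mem_inter, hY, and_true, add_div]
      split_ifs with c1 c2
      · have := ihl _ _ hl h1 c1
        simp; linarith
      · have := ihr _ _ hr h2 c2
        simp; linarith
      · simp
    · rename_i ea l' h1 h2
      simp only [Option.some.injEq, Prod.mk.injEq] at h
      rw [← h.2, ← h.1]
      have d1 := div_le_restrict _ _ _ _ h1 a ha
      have hn : x ∉ r.leafSet := fun hc => by
        have : x ∈ r.leafSet ∩ Y := Finset.mem_inter.2 ⟨hc, hY⟩
        rw [restrict_none _ _ h2] at this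
        simp at this
      have c1 : x ∈ l.leafSet := hx.resolve_right hn
      have := ihl _ _ hl h1 c1
      simp only [FP, c1, if_true, add_div]
      linarith
    · rename_i eb r' h1 h2
      simp only [Option.some.injEq, Prod.mk.injEq] at h
      rw [← h.2, ← h.1]
      have d1 := div_le_restrict _ _ _ _ h2 b hb
      have hn : x ∉ l.leafSet := fun hc => by
        have : x ∈ l.leafSet ∩ Y := Finset.mem_inter.2 ⟨hc, hY⟩
        rw [restrict_none _ _ h1] at this
        simp at this
      have c1 : x ∈ r.leafSet := hx.resolve_left hn
      have := ihr _ _ hr h2 c1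
      simp only [FP, hn, c1, if_true, if_false, add_div]
      linarith
    · simp at h

end Phylo.PhyloTree

open Phylo PhyloTree

/-- If some, but not all, leaves of `T_a` (and no leaf of `T_b`) are deleted
from `T = (T_a, T_b)`, then the FP index of every surviving leaf of `T_a` strictly
increases. -/
theorem fp_strictly_increases_in_affected_subtree {α : Type} [DecidableEq α]
    (Ta Tb : PhyloTree α) (la lb : ℝ) (T : PhyloTree α)
    (hT : T = PhyloTree.node Ta Tb la lb)
    (hleaf : T.distinctLeaves) (hpos : T.posLengths)
    (X' : Finset α) (hne : X'.Nonempty) (hX' : X' ⊂ Ta.leafSet) :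
    ∀ x ∈ Ta.leafSet \ X',
      T.FP x < (T.restrictTree (T.leafSet \ X')).FP x := by
  intro x hx
  subst hT
  obtain ⟨hxa, hxX⟩ := Finset.mem_sdiff.1 hx
  obtain ⟨hdis, -, -⟩ := hleaf
  obtain ⟨ha, hb, hpa, hpb⟩ := hpos
  set Y := (PhyloTree.node Ta Tb la lb).leafSet \ X' with hYdef
  have hxY : x ∈ Y := by
    rw [hYdef]; simp [leafSet, hxa, hxX]
  obtain ⟨z, hz⟩ := leafSet_nonempty' Tb
  have hzY : z ∈ Y := by
    have : z ∉ X' := fun hc => Finset.disjoint_left.1 hdis (hX'.1 hc) hz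
    rw [hYdef]; simp [leafSet, hz, this]
  rcases h1 : Ta.restrict? Y with _ | ⟨ea, l'⟩
  · have := restrict_none _ _ h1
    have h3 : x ∈ Ta.leafSet ∩ Y := Finset.mem_inter.2 ⟨hxa, hxY⟩
    rw [this] at h3
    simp at h3
  rcases h2 : Tb.restrict? Y with _ | ⟨eb, r'⟩
  · have := restrict_none _ _ h2
    have h3 : z ∈ Tb.leafSet ∩ Y := Finset.mem_inter.2 ⟨hz, hzY⟩
    rw [this] at h3
    simp at h3
  have m1 := restrict_some _ _ _ _ h1
  have hlt : (l'.numLeaves : ℝ) < Ta.numLeaves := by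
    have : l'.numLeaves < Ta.numLeaves := by
      unfold numLeaves
      apply Finset.card_lt_card
      rw [m1]
      obtain ⟨w, hw⟩ := hne
      refine ⟨Finset.inter_subset_left, fun hc => ?_⟩
      have := (Finset.mem_inter.1 (hc (hX'.1 hw))).2
      rw [hYdef] at this
      exact (Finset.mem_sdiff.1 this).2 hw
    exact_mod_cast this
  have d := div_lt_div_of_pos_left ha (numLeaves_pos' l') hlt
  have key := FP_le_restrict _ _ _ _ hpa h1 x hxa hxY
  have hxl : x ∈ l'.leafSet := by rw [m1]; exact Finset.mem_inter.2 ⟨hxa, hxY⟩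
  simp only [restrictTree, restrict?, h1, h2, FP, hxa, hxl, if_true, add_div]
  linarith
end

section
/- Let T be a rooted binary phylogenetic tree on leaf set X = {x_1, …, x_n}, and let θ = (θ_1, …, θ_n) ∈ ℝ^n_{>0} be a vector of strictly positive real numbers. Then there exists an assignment of strictly positive edge lengths to T such that the induced Fair Proportion indices equal θ, i.e. FP_T(x_i) = θ_i for all i = 1, …, n. -/
open scoped Classical

open Phylo PhyloTree

theorem aux_node {α : Type} [DecidableEq α] (l r l' r' : PhyloTree α) (a b c d : ℝ)
    (hd : Disjoint l.leafSet r.leafSet) (θ : α → ℝ)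
    (hl : l'.leafSet = l.leafSet) (hr : r'.leafSet = r.leafSet)
    (h1 : ∀ x ∈ l.leafSet, l'.FP x + c = θ x) (h2 : ∀ x ∈ r.leafSet, r'.FP x + d = θ x)
    (ha : a / (l'.numLeaves : ℝ) = c) (hb : b / (r'.numLeaves : ℝ) = d) :
    ∀ x ∈ (node l r 0 0).leafSet, (node l' r' a b).FP x = θ x := by
  intro x hx
  simp only [leafSet, Finset.mem_union] at hx
  simp only [FP, hl, hr, ha, hb]
  by_cases hxl : x ∈ l.leafSet
  · rw [if_pos hxl, h1 x hxl]
  · have hxr := hx.resolve_left hxl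
    rw [if_neg hxl, if_pos hxr, h2 x hxr]

theorem aux_nonempty {α : Type} [DecidableEq α] (T : PhyloTree α) : T.leafSet.Nonempty := by
  induction T with
  | leaf x => simp [leafSet]
  | node l r a b ihl ihr => exact ihl.mono (by simp [leafSet])

theorem aux_pos {α : Type} [DecidableEq α] (T : PhyloTree α) : (0 : ℝ) < T.numLeaves := by
  exact_mod_cast (aux_nonempty T).card_pos

theorem aux_main {α : Type} [DecidableEq α] (T : PhyloTree α) (hleaf : T.distinctLeaves) :
    ∀ (θ : α → ℝ), (∀ x ∈ T.leafSet, 0 < θ x) →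
    ∃ (T' : PhyloTree α) (c : ℝ), 0 < c ∧ T'.leafSet = T.leafSet ∧ T.sameShape T' ∧
      T'.posLengths ∧ ∀ x ∈ T.leafSet, T'.FP x + c = θ x := by
  induction T with
  | leaf x =>
    intro θ hθ
    exact ⟨leaf x, θ x, hθ x (by simp [leafSet]), rfl, by simp [sameShape],
      by simp [posLengths], by simp [leafSet, FP]⟩
  | node l r a b ihl ihr =>
    intro θ hθ
    obtain ⟨hd, hdl, hdr⟩ := hleaf
    obtain ⟨y, hy, hmin⟩ := Finset.exists_min_image _ θ (aux_nonempty (node l r a b))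
    have hy0 := hθ y hy
    have key : ∀ x ∈ (node l r a b).leafSet, 0 < θ x - θ y / 2 := by
      intro x hx
      have := hmin x hx
      linarith
    obtain ⟨l', c, hc, hl, hsl, hpl, h1⟩ := ihl hdl (fun x => θ x - θ y / 2)
      (fun x hx => key x (by simp [leafSet, hx]))
    obtain ⟨r', d, hd', hr, hsr, hpr, h2⟩ := ihr hdr (fun x => θ x - θ y / 2)
      (fun x hx => key x (by simp [leafSet, hx]))
    have pl := aux_pos l'
    have pr := aux_pos r'
    refine ⟨node l' r' (c * l'.numLeaves) (d * r'.numLeaves), θ y / 2, by linarith,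
      by simp [leafSet, hl, hr], ⟨hsl, hsr⟩, ⟨by positivity, by positivity, hpl, hpr⟩, ?_⟩
    intro x hx
    rw [aux_node l r l' r' _ _ c d hd _ hl hr h1 h2 (by field_simp) (by field_simp) x hx]
    ring

/-- Every vector of strictly positive real numbers indexed by the leaves of a
rooted binary phylogenetic tree can be realized as the vector of FP indices by a suitable
assignment of strictly positive edge lengths. -/
theorem exists_lengths_realizing_fp_values {α : Type} [DecidableEq α]
    (T : PhyloTree α) (hleaf : T.distinctLeaves) (hn : 2 ≤ T.numLeaves)
    (θ : α → ℝ) (hθ : ∀ x ∈ T.leafSet, 0 < θ x) :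
    ∃ T' : PhyloTree α, T.sameShape T' ∧ T'.posLengths ∧
      ∀ x ∈ T.leafSet, T'.FP x = θ x := by
  cases T with
  | leaf x => simp [numLeaves, leafSet] at hn
  | node l r a b =>
    obtain ⟨hd, hdl, hdr⟩ := hleaf
    obtain ⟨l', c, hc, hl, hsl, hpl, h1⟩ := aux_main l hdl θ
      (fun x hx => hθ x (by simp [leafSet, hx]))
    obtain ⟨r', d, hd', hr, hsr, hpr, h2⟩ := aux_main r hdr θ
      (fun x hx => hθ x (by simp [leafSet, hx]))
    have pl := aux_pos l'
    have pr := aux_pos r'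
    exact ⟨node l' r' (c * l'.numLeaves) (d * r'.numLeaves), ⟨hsl, hsr⟩,
      ⟨by positivity, by positivity, hpl, hpr⟩,
      fun x hx => aux_node l r l' r' _ _ c d hd _ hl hr h1 h2
        (by field_simp) (by field_simp) x hx⟩
end
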